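/- Let {R_n}_{n∈ℕ} be a process and set Δ_n := R_n △ (R_n + (0,1)) (the symmetric difference of R_n and its translate by (0,1)). Then #(Δ_n ∩ ℤ²)/#(R_n ∩ ℤ²) → 0 as n → ∞. Consequently, for every probability space (X,𝒜,μ) with commuting, invertible, measure-preserving, ergodic transformations S,T, every c ∈ ℝ and every g ∈ L^∞(X), the averages M_n(c + g − g∘T)(x) converge to c for almost every x ∈ X. -/

import Mathlib

open MeasureTheory Filter Topology Set
open scoped ENNReal Pointwise BigOperators

noncomputable section

/-- A (possibly tilted) closed rectangle in the plane, described by a corner,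
an angle, and two positive side lengths. -/
structure Rect where
  corner : ℝ × ℝ
  angle : ℝ
  len1 : ℝ
  len2 : ℝ
  len1_pos : 0 < len1
  len2_pos : 0 < len2

namespace Rect

/-- The set of points of a rectangle. -/
def carrier (R : Rect) : Set (ℝ × ℝ) :=
  {p | ∃ s t : ℝ, s ∈ Icc (0 : ℝ) R.len1 ∧ t ∈ Icc (0 : ℝ) R.len2 ∧
    p = R.corner + s • (Real.cos R.angle, Real.sin R.angle) +
      t • (-Real.sin R.angle, Real.cos R.angle)}

/-- `l(R)`: the length of the shortest side. -/
def shortSide (R : Rect) : ℝ := min R.len1 R.len2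

/-- `L(R)`: the length of the longest side. -/
def longSide (R : Rect) : ℝ := max R.len1 R.len2

/-- The slope of a rectangle: the tangent of the angle formed between its longest
side and the horizontal axis (canonical choice for squares). -/
def slope (R : Rect) : ℝ :=
  if R.len2 ≤ R.len1 then Real.tan R.angle else Real.tan (R.angle + Real.pi / 2)

end Rect

/-- The integer lattice points lying in a planar set. -/
def latticePts (F : Set (ℝ × ℝ)) : Set (ℤ × ℤ) := {p | ((p.1 : ℝ), (p.2 : ℝ)) ∈ F}

/-- `#(F ∩ ℤ²)`: the number of integer lattice points in `F`. -/
def latticeCount (F : Set (ℝ × ℝ)) : ℕ := (latticePts F).ncard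

/-- A process: a sequence of rectangles containing `(0,0)` whose shortest sides
tend to infinity. -/
def IsProcess (R : ℕ → Rect) : Prop :=
  (∀ n, ((0 : ℝ), (0 : ℝ)) ∈ (R n).carrier) ∧
    Tendsto (fun n => (R n).shortSide) atTop atTop

variable {X : Type*} [MeasurableSpace X]

/-- The ergodic average `M_R f(x) = (1/#(R ∩ ℤ²)) ∑_{(i,j) ∈ R ∩ ℤ²} f(S^i T^j x)`. -/
def ergAvg (S T : X ≃ᵐ X) (R : Rect) (f : X → ℝ) (x : X) : ℝ :=
  (latticeCount R.carrier : ℝ)⁻¹ *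
    ∑ᶠ p ∈ latticePts R.carrier, f ((S.toEquiv ^ p.1) ((T.toEquiv ^ p.2) x))

/-- The maximal operator `M* f = sup_n M_n |f|`. -/
def maxOp (S T : X ≃ᵐ X) (R : ℕ → Rect) (f : X → ℝ) (x : X) : ℝ≥0∞ :=
  ⨆ n, ENNReal.ofReal (ergAvg S T (R n) (fun y => |f y|) x)

/-- The maximal operator `M'* f = sup_n |M_n f|`. -/
def maxOpAbs (S T : X ≃ᵐ X) (R : ℕ → Rect) (f : X → ℝ) (x : X) : ℝ≥0∞ :=
  ⨆ n, ENNReal.ofReal |ergAvg S T (R n) f x|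

/-- `S, T` form a pair of commuting, invertible, measure-preserving, ergodic
transformations of the probability space `(X, μ)`. -/
structure ErgodicSetup (μ : Measure X) (S T : X ≃ᵐ X) : Prop where
  prob : IsProbabilityMeasure μ
  measPres_S : MeasurePreserving (⇑S) μ μ
  measPres_T : MeasurePreserving (⇑T) μ μ
  comm : ∀ x, S (T x) = T (S x)
  erg_S : Ergodic (⇑S) μ
  erg_T : Ergodic (⇑T) μ

/-- An operator `M` is of weak-type `(p,p)`. -/
def IsWeakType (μ : Measure X) (M : (X → ℝ) → X → ℝ≥0∞) (p : ℝ) : Prop :=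
  ∃ C : ℝ, 0 < C ∧ ∀ f : X → ℝ, MemLp f (ENNReal.ofReal p) μ → ∀ lam : ℝ, 0 < lam →
    μ {x | ENNReal.ofReal lam < M f x} ≤
      ENNReal.ofReal (C * ((eLpNorm f (ENNReal.ofReal p) μ).toReal / lam) ^ p)

/-- The averages `M_n f` converge almost everywhere. -/
def AEConverges (μ : Measure X) (S T : X ≃ᵐ X) (R : ℕ → Rect) (f : X → ℝ) : Prop :=
  ∀ᵐ x ∂μ, ∃ L : ℝ, Tendsto (fun n => ergAvg S T (R n) f x) atTop (𝓝 L)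

/-- The maximal operator `M*` satisfies a Tauberian condition. -/
def ErgTauberian (μ : Measure X) (S T : X ≃ᵐ X) (R : ℕ → Rect) : Prop :=
  ∀ lam : ℝ, 0 < lam → lam < 1 → ∃ C : ℝ, 0 < C ∧ ∀ A : Set X, MeasurableSet A →
    0 < μ A → μ A < ⊤ →
    μ {x | ENNReal.ofReal lam < maxOp S T R (A.indicator fun _ => (1 : ℝ)) x} ≤
      ENNReal.ofReal C * μ A

/-- A `p`-good process: on every probability space with a commuting, invertible,
measure-preserving, ergodic pair, the averages converge a.e. for every `f ∈ L^p`. -/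
def IsGoodProcess (R : ℕ → Rect) (p : ℝ≥0∞) : Prop :=
  ∀ (Y : Type) [MeasurableSpace Y], ∀ (μ : Measure Y) (S T : Y ≃ᵐ Y),
    ErgodicSetup μ S T → ∀ f : Y → ℝ, MemLp f p μ → AEConverges μ S T R f

/-- The discrete average `A_R φ(k,l)`. -/
def discAvg (R : Rect) (φ : ℤ × ℤ → ℝ) (kl : ℤ × ℤ) : ℝ :=
  (latticeCount R.carrier : ℝ)⁻¹ *
    ∑ᶠ p ∈ latticePts R.carrier, φ (kl.1 + p.1, kl.2 + p.2)

/-- The discrete maximal operator `A* φ = sup_n A_n |φ|`. -/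
def discMaxOp (R : ℕ → Rect) (φ : ℤ × ℤ → ℝ) (kl : ℤ × ℤ) : ℝ≥0∞ :=
  ⨆ n, ENNReal.ofReal (discAvg (R n) (fun q => |φ q|) kl)

/-- The `N`-truncated discrete maximal operator `A*_N φ = sup_{n ≥ N} A_n |φ|`. -/
def discMaxOpFrom (R : ℕ → Rect) (N : ℕ) (φ : ℤ × ℤ → ℝ) (kl : ℤ × ℤ) : ℝ≥0∞ :=
  ⨆ n, ⨆ (_ : N ≤ n), ENNReal.ofReal (discAvg (R n) (fun q => |φ q|) kl)

def lpSum (φ : ℤ × ℤ → ℝ) (p : ℝ) : ℝ≥0∞ := ∑' q : ℤ × ℤ, ENNReal.ofReal (|φ q| ^ p)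

/-- `φ ∈ ℓ^p(ℤ²)`. -/
def Memlp (φ : ℤ × ℤ → ℝ) (p : ℝ) : Prop := lpSum φ p < ⊤

/-- The `ℓ^p(ℤ²)` norm. -/
def lpNorm (φ : ℤ × ℤ → ℝ) (p : ℝ) : ℝ≥0∞ := lpSum φ p ^ (1 / p)

/-- The `ℓ^p(ℤ²)` norm of an `ℝ≥0∞`-valued function. -/
def lpNormE (F : ℤ × ℤ → ℝ≥0∞) (p : ℝ) : ℝ≥0∞ := (∑' q : ℤ × ℤ, F q ^ p) ^ (1 / p)

/-- A discrete operator `B` is of weak-type `(p,p)` on `ℓ^p(ℤ²)`. -/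
def IsDiscWeakType (B : (ℤ × ℤ → ℝ) → ℤ × ℤ → ℝ≥0∞) (p : ℝ) : Prop :=
  ∃ C : ℝ, 0 < C ∧ ∀ φ : ℤ × ℤ → ℝ, Memlp φ p → ∀ lam : ℝ, 0 < lam →
    Measure.count {kl : ℤ × ℤ | ENNReal.ofReal lam ≤ B φ kl} ≤
      ENNReal.ofReal (C * ((lpNorm φ p).toReal / lam) ^ p)

/-- The discrete maximal operator associated with `R` satisfies a Tauberian condition. -/
def DiscTauberian (R : ℕ → Rect) : Prop :=
  ∀ lam : ℝ, 0 < lam → ∃ C : ℝ, 0 < C ∧ ∀ E : Finset (ℤ × ℤ), E.Nonempty →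
    Measure.count {kl : ℤ × ℤ |
        ENNReal.ofReal lam ≤ discMaxOp R (fun q => if q ∈ E then (1 : ℝ) else 0) kl} ≤
      ENNReal.ofReal C * (E.card : ℝ≥0∞)

/-- Vertices and sets of the geometric construction 1 (with `A = (1,0)`,
`B = (0,b)`, `C = (0,c)`). -/
def ptA : ℝ × ℝ := (1, 0)
def ptB (b : ℝ) : ℝ × ℝ := (0, b)
def ptC (c : ℝ) : ℝ × ℝ := (0, c)
def ptB' (b : ℝ) : ℝ × ℝ := ptA + (3 / 2 : ℝ) • (ptB b - ptA)
def ptC' (c : ℝ) : ℝ × ℝ := ptA + (3 / 2 : ℝ) • (ptC c - ptA)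

/-- The full triangle `ABC`. -/
def triABC (b c : ℝ) : Set (ℝ × ℝ) := convexHull ℝ {ptA, ptB b, ptC c}

/-- The full trapezium `BCC'B'`. -/
def trapV (b c : ℝ) : Set (ℝ × ℝ) := convexHull ℝ {ptB b, ptC c, ptC' c, ptB' b}

/-- The rectangle `P`: the smallest rectangle having `AC'` as one of its sides and
containing the triangle `AB'C'`, translated so that its center is the origin.
Its sides have directions `(-1,c)/√(1+c²)` and `(c,1)/√(1+c²)`, with half-lengths
`(3/4)√(1+c²)` and `(3/4)(b-c)/√(1+c²)`. -/
def rectP (b c : ℝ) : Set (ℝ × ℝ) :=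
  {p : ℝ × ℝ |
    |(-p.1 + c * p.2)| / Real.sqrt (1 + c ^ 2) ≤ (3 / 4) * Real.sqrt (1 + c ^ 2) ∧
    |(c * p.1 + p.2)| / Real.sqrt (1 + c ^ 2) ≤ (3 / 4) * (b - c) / Real.sqrt (1 + c ^ 2)}

/-- Horizontal translation of a planar set by `t`. -/
def hTranslate (t : ℝ) (F : Set (ℝ × ℝ)) : Set (ℝ × ℝ) :=
  (fun p : ℝ × ℝ => (p.1 + t, p.2)) '' F

/-- The triangle `Δ_k` with vertices `A = (0,1)`, `B_{k-1} = (u_{k-1}, 0)`,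
`B_k = (u_k, 0)`. -/
def triPerron (u : ℕ → ℝ) (k : ℕ) : Set (ℝ × ℝ) :=
  convexHull ℝ {((0 : ℝ), (1 : ℝ)), ((u (k - 1) : ℝ), (0 : ℝ)), ((u k : ℝ), (0 : ℝ))}

/-- The symmetric difference `Δ_n := R_n △ (R_n + (0,1))`. -/
def symmDiffTranslate (R : Rect) : Set (ℝ × ℝ) :=
  symmDiff R.carrier ((fun q : ℝ × ℝ => q + ((0 : ℝ), (1 : ℝ))) '' R.carrier)


def rU (R : Rect) (p : ℤ × ℤ) : ℝ :=
  ((p.1 : ℝ) - R.corner.1) * Real.cos R.angle + ((p.2 : ℝ) - R.corner.2) * Real.sin R.angle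

def rV (R : Rect) (p : ℤ × ℤ) : ℝ :=
  -((p.1 : ℝ) - R.corner.1) * Real.sin R.angle + ((p.2 : ℝ) - R.corner.2) * Real.cos R.angle

theorem mem_lat (R : Rect) (p : ℤ × ℤ) : p ∈ latticePts R.carrier ↔
    (0 ≤ rU R p ∧ rU R p ≤ R.len1) ∧ (0 ≤ rV R p ∧ rV R p ≤ R.len2) := by
  have hcs := Real.sin_sq_add_cos_sq R.angle
  unfold latticePts Rect.carrier rU rV
  simp only [Set.mem_setOf_eq, Set.mem_Icc]
  constructor
  · rintro ⟨s, t, ⟨hs0, hs1⟩, ⟨ht0, ht1⟩, h⟩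
    have h1 := congrArg Prod.fst h
    have h2 := congrArg Prod.snd h
    simp at h1 h2
    have e1 : ((p.1 : ℝ) - R.corner.1) * Real.cos R.angle +
        ((p.2 : ℝ) - R.corner.2) * Real.sin R.angle = s := by
      rw [h1, h2]; linear_combination s * hcs
    have e2 : -((p.1 : ℝ) - R.corner.1) * Real.sin R.angle +
        ((p.2 : ℝ) - R.corner.2) * Real.cos R.angle = t := by
      rw [h1, h2]; linear_combination t * hcs
    rw [e1, e2]
    exact ⟨⟨hs0, hs1⟩, ht0, ht1⟩
  · rintro ⟨h1, h2⟩
    refine ⟨_, _, h1, h2, ?_⟩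
    ext
    · simp
      linear_combination (-((p.1 : ℝ) - R.corner.1)) * hcs
    · simp
      linear_combination (-((p.2 : ℝ) - R.corner.2)) * hcs

theorem abs_comb {x y c s B D : ℝ} (hc : |c| ≤ 1) (hs : |s| ≤ 1) (hx : |x| ≤ B) (hy : |y| ≤ D) :
    |x * c + y * s| ≤ B + D := by
  have h1 : |x * c| ≤ B := by
    rw [abs_mul]; nlinarith [abs_nonneg x, abs_nonneg c]
  have h2 : |y * s| ≤ D := by
    rw [abs_mul]; nlinarith [abs_nonneg y, abs_nonneg s]
  exact (abs_add_le _ _).trans (add_le_add h1 h2)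

theorem lat_finite (R : Rect) : (latticePts R.carrier).Finite := by
  have hcs := Real.sin_sq_add_cos_sq R.angle
  set B := R.len1 + R.len2 with hB
  apply (Set.finite_Icc ((⌊R.corner.1 - B⌋, ⌊R.corner.2 - B⌋) : ℤ × ℤ)
    (⌈R.corner.1 + B⌉, ⌈R.corner.2 + B⌉)).subset
  intro p hp
  rw [mem_lat] at hp
  obtain ⟨⟨h1, h2⟩, h3, h4⟩ := hp
  have hu : |rU R p| ≤ R.len1 := abs_le.2 ⟨by linarith, h2⟩
  have hv : |rV R p| ≤ R.len2 := abs_le.2 ⟨by linarith, h4⟩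
  have hs : |Real.sin R.angle| ≤ 1 := Real.abs_sin_le_one _
  have hc : |Real.cos R.angle| ≤ 1 := Real.abs_cos_le_one _
  have hs' : |-Real.sin R.angle| ≤ 1 := by rwa [abs_neg]
  have e1 : rU R p * Real.cos R.angle + rV R p * (-Real.sin R.angle) = p.1 - R.corner.1 := by
    unfold rU rV; linear_combination ((p.1 : ℝ) - R.corner.1) * hcs
  have e2 : rU R p * Real.sin R.angle + rV R p * Real.cos R.angle = p.2 - R.corner.2 := by
    unfold rU rV; linear_combination ((p.2 : ℝ) - R.corner.2) * hcs
  have b1 := abs_comb hc hs' hu hv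
  have b2 := abs_comb hs hc hu hv
  rw [e1, abs_le] at b1
  rw [e2, abs_le] at b2
  refine ⟨⟨?_, ?_⟩, ⟨?_, ?_⟩⟩
  · have := Int.floor_le (R.corner.1 - B)
    have : ((⌊R.corner.1 - B⌋ : ℤ) : ℝ) ≤ p.1 := by linarith
    exact_mod_cast this
  · have := Int.floor_le (R.corner.2 - B)
    have : ((⌊R.corner.2 - B⌋ : ℤ) : ℝ) ≤ p.2 := by linarith
    exact_mod_cast this
  · have := Int.le_ceil (R.corner.1 + B)
    have : (p.1 : ℝ) ≤ (⌈R.corner.1 + B⌉ : ℤ) := by linarith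
    exact_mod_cast this
  · have := Int.le_ceil (R.corner.2 + B)
    have : (p.2 : ℝ) ≤ (⌈R.corner.2 + B⌉ : ℤ) := by linarith
    exact_mod_cast this

def sg (b : Bool) : ℝ := if b then 1 else -1

theorem move_aux {u a l e m : ℝ} (h0 : 0 ≤ u) (h1 : u ≤ a) (hl : l ≤ a) (he : |e| ≤ m + m)
    (hm : 8 * m ≤ l) : 0 ≤ u + l / 4 * sg (decide (u ≤ a / 2)) + e ∧
      u + l / 4 * sg (decide (u ≤ a / 2)) + e ≤ a := by
  rw [abs_le] at he
  unfold sg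
  by_cases h : u ≤ a / 2
  · simp [h]; constructor <;> linarith
  · simp [h]; push Not at h; constructor <;> linarith

theorem count_le (R : Rect) (m : ℕ) (hm : 1 ≤ m) (hl : 8 * (m : ℝ) ≤ R.shortSide)
    (A : Set (ℤ × ℤ)) (hA : A ⊆ latticePts R.carrier)
    (hinj : ∀ p ∈ A, ∀ q ∈ A, p.1 = q.1 → p = q) :
    A.ncard * m ≤ 4 * latticeCount R.carrier := by
  classical
  have hcs := Real.sin_sq_add_cos_sq R.angle
  have hAf : A.Finite := (lat_finite R).subset hA
  set F := hAf.toFinset with hF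
  set G := (lat_finite R).toFinset with hG
  have hAc : A.ncard = F.card := Set.ncard_eq_toFinset_card A hAf
  have hGc : latticeCount R.carrier = G.card := Set.ncard_eq_toFinset_card _ (lat_finite R)
  set l := R.shortSide with hl'
  let w : Bool → Bool → ℤ × ℤ := fun α β =>
    (⌊l / 4 * (sg α * Real.cos R.angle - sg β * Real.sin R.angle)⌋,
     ⌊l / 4 * (sg α * Real.sin R.angle + sg β * Real.cos R.angle)⌋)
  let s1 : ℤ × ℤ → Bool := fun p => decide (rU R p ≤ R.len1 / 2)
  let s2 : ℤ × ℤ → Bool := fun p => decide (rV R p ≤ R.len2 / 2)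
  let f : (ℤ × ℤ) × (ℕ × ℕ) → (ℤ × ℤ) × ((Bool × Bool) × ℕ) := fun z =>
    ((z.1.1 + (w (s1 z.1) (s2 z.1)).1 + z.2.1, z.1.2 + (w (s1 z.1) (s2 z.1)).2 + z.2.2),
      ((s1 z.1, s2 z.1), z.2.1))
  have key : (F ×ˢ (Finset.range m ×ˢ Finset.range m)).card ≤
      (G ×ˢ ((Finset.univ : Finset (Bool × Bool)) ×ˢ Finset.range m)).card := by
    apply Finset.card_le_card_of_injOn f
    · rintro ⟨p, i, j⟩ hz
      simp only [Finset.coe_product, Set.mem_prod, Finset.mem_coe, Finset.mem_range] at hz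
      obtain ⟨hp, hi, hj⟩ := hz
      have hp' : p ∈ latticePts R.carrier := hA (hAf.mem_toFinset.1 hp)
      simp only [Finset.coe_product, Set.mem_prod, Finset.mem_coe, Finset.mem_range, f,
        Finset.mem_univ, hi, true_and, and_true]
      rw [hG, Set.Finite.mem_toFinset, mem_lat]
      rw [mem_lat] at hp'
      obtain ⟨⟨h1, h2⟩, h3, h4⟩ := hp'
      have hiR : (i : ℝ) + 1 ≤ m := by exact_mod_cast hi
      have hjR : (j : ℝ) + 1 ≤ m := by exact_mod_cast hj
      have hi0 : (0 : ℝ) ≤ i := by positivity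
      have hj0 : (0 : ℝ) ≤ j := by positivity
      have hla : l ≤ R.len1 := min_le_left _ _
      have hlb : l ≤ R.len2 := min_le_right _ _
      set α := sg (s1 p) with hα
      set β := sg (s2 p) with hβ
      have f1 := Int.floor_le (l / 4 * (α * Real.cos R.angle - β * Real.sin R.angle))
      have f2 := Int.lt_floor_add_one (l / 4 * (α * Real.cos R.angle - β * Real.sin R.angle))
      have f3 := Int.floor_le (l / 4 * (α * Real.sin R.angle + β * Real.cos R.angle))
      have f4 := Int.lt_floor_add_one (l / 4 * (α * Real.sin R.angle + β * Real.cos R.angle))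
      have hw1 : (w (s1 p) (s2 p)).1 =
        ⌊l / 4 * (α * Real.cos R.angle - β * Real.sin R.angle)⌋ := rfl
      have hw2 : (w (s1 p) (s2 p)).2 =
        ⌊l / 4 * (α * Real.sin R.angle + β * Real.cos R.angle)⌋ := rfl
      rw [← hw1] at f1 f2
      rw [← hw2] at f3 f4
      obtain ⟨e, he⟩ : ∃ e : ℝ, e = ((w (s1 p) (s2 p)).1 : ℝ) + i -
        l / 4 * (α * Real.cos R.angle - β * Real.sin R.angle) := ⟨_, rfl⟩
      obtain ⟨d, hd⟩ : ∃ d : ℝ, d = ((w (s1 p) (s2 p)).2 : ℝ) + j -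
        l / 4 * (α * Real.sin R.angle + β * Real.cos R.angle) := ⟨_, rfl⟩
      have heb : |e| ≤ m := abs_le.2 ⟨by linarith, by linarith⟩
      have hdb : |d| ≤ m := abs_le.2 ⟨by linarith, by linarith⟩
      have hs : |Real.sin R.angle| ≤ 1 := Real.abs_sin_le_one _
      have hc : |Real.cos R.angle| ≤ 1 := Real.abs_cos_le_one _
      have hs' : |-Real.sin R.angle| ≤ 1 := by rwa [abs_neg]
      have m1 := move_aux h1 h2 hla (abs_comb hc hs heb hdb) hl
      have m2 := move_aux h3 h4 hlb (abs_comb hs' hc heb hdb) hl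
      have hα' : sg (decide (rU R p ≤ R.len1 / 2)) = α := rfl
      have hβ' : sg (decide (rV R p ≤ R.len2 / 2)) = β := rfl
      rw [hα'] at m1
      rw [hβ'] at m2
      have g1 : rU R (p.1 + (w (s1 p) (s2 p)).1 + i, p.2 + (w (s1 p) (s2 p)).2 + j) =
          rU R p + l / 4 * α + (e * Real.cos R.angle + d * Real.sin R.angle) := by
        rw [he, hd]; unfold rU; push_cast
        linear_combination -(l / 4 * α) * (-hcs)
      have g2 : rV R (p.1 + (w (s1 p) (s2 p)).1 + i, p.2 + (w (s1 p) (s2 p)).2 + j) =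
          rV R p + l / 4 * β + (e * -Real.sin R.angle + d * Real.cos R.angle) := by
        rw [he, hd]; unfold rV; push_cast
        linear_combination -(l / 4 * β) * (-hcs)
      rw [g1, g2]
      exact ⟨m1, m2⟩
    · rintro ⟨p, i, j⟩ hz ⟨p', i', j'⟩ hz' h
      simp only [Finset.coe_product, Set.mem_prod, Finset.mem_coe, Finset.mem_range] at hz hz'
      simp only [f, Prod.mk.injEq] at h
      obtain ⟨⟨h1, h2⟩, ⟨h3, h4⟩, h5⟩ := h
      rw [h3, h4] at h1 h2
      subst h5
      have hpp : p = p' := by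
        apply hinj p (hAf.mem_toFinset.1 hz.1) p' (hAf.mem_toFinset.1 hz'.1)
        linarith
      subst hpp
      have : j = j' := by
        have : (j : ℤ) = j' := by linarith
        exact_mod_cast this
      rw [this]
  simp only [Finset.card_product, Finset.card_range, Finset.card_univ, Fintype.card_prod,
    Fintype.card_bool] at key
  rw [hAc, hGc]
  have : F.card * m * m ≤ 4 * G.card * m := by nlinarith
  exact Nat.le_of_mul_le_mul_right this hm

/-- Lattice version of convexity in the vertical direction. -/
theorem col_convex (R : Rect) (x y z t : ℤ) (h1 : (x, y) ∈ latticePts R.carrier)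
    (h2 : (x, t) ∈ latticePts R.carrier) (hyz : y ≤ z) (hzt : z ≤ t) :
    (x, z) ∈ latticePts R.carrier := by
  rw [mem_lat] at *
  unfold rU rV at *
  simp only at *
  obtain ⟨⟨a1, a2⟩, a3, a4⟩ := h1
  obtain ⟨⟨b1, b2⟩, b3, b4⟩ := h2
  have hy : (y : ℝ) ≤ z := by exact_mod_cast hyz
  have ht : (z : ℝ) ≤ t := by exact_mod_cast hzt
  refine ⟨⟨?_, ?_⟩, ?_, ?_⟩
  · rcases le_total 0 (Real.sin R.angle) with h | h <;> nlinarith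
  · rcases le_total 0 (Real.sin R.angle) with h | h <;> nlinarith
  · rcases le_total 0 (Real.cos R.angle) with h | h <;> nlinarith
  · rcases le_total 0 (Real.cos R.angle) with h | h <;> nlinarith

theorem shift_mem (R : Rect) (p : ℤ × ℤ) :
    (((p.1 : ℝ), (p.2 : ℝ)) ∈ (fun q : ℝ × ℝ => q + ((0 : ℝ), (1 : ℝ))) '' R.carrier) ↔
      (p.1, p.2 - 1) ∈ latticePts R.carrier := by
  unfold latticePts
  simp only [Set.mem_image, Set.mem_setOf_eq]
  constructor
  · rintro ⟨q, hq, h⟩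
    have h1 := congrArg Prod.fst h
    have h2 := congrArg Prod.snd h
    simp at h1 h2
    have : q = ((p.1 : ℝ), ((p.2 - 1 : ℤ) : ℝ)) := by
      ext
      · simpa using h1
      · push_cast; linarith
    rwa [this] at hq
  · intro h
    refine ⟨_, h, ?_⟩
    ext <;> simp

def botS (R : Rect) : Set (ℤ × ℤ) :=
  {p | p ∈ latticePts R.carrier ∧ (p.1, p.2 - 1) ∉ latticePts R.carrier}
def topS (R : Rect) : Set (ℤ × ℤ) :=
  {p | p ∈ latticePts R.carrier ∧ (p.1, p.2 + 1) ∉ latticePts R.carrier}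

theorem lat_delta (R : Rect) : latticePts (symmDiffTranslate R) =
    botS R ∪ (fun p : ℤ × ℤ => (p.1, p.2 + 1)) '' topS R := by
  ext p
  have : p ∈ latticePts (symmDiffTranslate R) ↔
    (p ∈ latticePts R.carrier ∧ (p.1, p.2 - 1) ∉ latticePts R.carrier) ∨
    ((p.1, p.2 - 1) ∈ latticePts R.carrier ∧ p ∉ latticePts R.carrier) := by
    rw [← shift_mem]
    rfl
  rw [this]
  apply or_congr Iff.rfl
  simp only [Set.mem_image, topS, Set.mem_setOf_eq]
  constructor
  · rintro ⟨h1, h2⟩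
    exact ⟨(p.1, p.2 - 1), ⟨h1, by simpa using h2⟩, by simp⟩
  · rintro ⟨q, ⟨h1, h2⟩, rfl⟩
    exact ⟨by simpa using h1, h2⟩

theorem delta_finite (R : Rect) : (latticePts (symmDiffTranslate R)).Finite := by
  rw [lat_delta]
  exact ((lat_finite R).subset fun p hp => hp.1).union
    (((lat_finite R).subset fun p hp => hp.1).image _)

theorem delta_le (R : Rect) (m : ℕ) (hm : 1 ≤ m) (hl : 8 * (m : ℝ) ≤ R.shortSide) :
    latticeCount (symmDiffTranslate R) * m ≤ 8 * latticeCount R.carrier := by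
  have hb := count_le R m hm hl (botS R) (fun p hp => hp.1) (by
    rintro ⟨x, y⟩ ⟨h1, h2⟩ ⟨x', y'⟩ ⟨h3, h4⟩ h
    simp only at h h2 h4
    subst h
    rcases lt_trichotomy y y' with h | h | h
    · exact absurd (col_convex R x y (y' - 1) y' h1 h3 (by omega) (by omega)) h4
    · rw [h]
    · exact absurd (col_convex R x y' (y - 1) y h3 h1 (by omega) (by omega)) h2)
  have ht := count_le R m hm hl (topS R) (fun p hp => hp.1) (by
    rintro ⟨x, y⟩ ⟨h1, h2⟩ ⟨x', y'⟩ ⟨h3, h4⟩ h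
    simp only at h h2 h4
    subst h
    rcases lt_trichotomy y y' with h | h | h
    · exact absurd (col_convex R x y (y + 1) y' h1 h3 (by omega) (by omega)) h2
    · rw [h]
    · exact absurd (col_convex R x y' (y' + 1) y h3 h1 (by omega) (by omega)) h4)
  have hu : latticeCount (symmDiffTranslate R) ≤ (botS R).ncard + (topS R).ncard := by
    unfold latticeCount
    rw [lat_delta]
    refine (Set.ncard_union_le _ _).trans (Nat.add_le_add_left ?_ _)
    exact Set.ncard_image_le ((lat_finite R).subset fun p hp => hp.1)
  nlinarith

theorem lat_pos (R : Rect) (h : ((0 : ℝ), (0 : ℝ)) ∈ R.carrier) : 0 < latticeCount R.carrier := by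
  unfold latticeCount
  rw [Set.ncard_pos (lat_finite R)]
  exact ⟨(0, 0), by simpa [latticePts] using h⟩

theorem part1 (R : ℕ → Rect) (hR : IsProcess R) :
    Tendsto (fun n => (latticeCount (symmDiffTranslate (R n)) : ℝ) /
      (latticeCount (R n).carrier : ℝ)) atTop (𝓝 0) := by
  rw [Metric.tendsto_atTop']
  intro ε hε
  obtain ⟨m, hm⟩ := exists_nat_gt (8 / ε)
  have hm0 : (0 : ℝ) < m := lt_trans (by positivity) hm
  have hm1 : 1 ≤ m := by exact_mod_cast hm0
  obtain ⟨N, hN⟩ := eventually_atTop.1 (hR.2.eventually_ge_atTop (8 * (m : ℝ)))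
  refine ⟨N, fun n hn => ?_⟩
  have h := delta_le (R n) m hm1 (hN n hn.le)
  have h' : (latticeCount (symmDiffTranslate (R n)) : ℝ) * m ≤
      8 * latticeCount (R n).carrier := by exact_mod_cast h
  have hp : (0 : ℝ) < latticeCount (R n).carrier := by exact_mod_cast lat_pos _ (hR.1 n)
  rw [Real.dist_eq, sub_zero, abs_of_nonneg (by positivity), div_lt_iff₀ hp]
  rw [div_lt_iff₀ hε] at hm
  by_contra hcon
  push Not at hcon
  nlinarith

theorem sum_diff_le (R : Rect) (G : ℤ × ℤ → ℝ) (K : ℝ) (hG : ∀ p, |G p| ≤ K) :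
    |∑ p ∈ (lat_finite R).toFinset, (G p - G (p.1, p.2 + 1))| ≤
      K * latticeCount (symmDiffTranslate R) := by
  classical
  set F := (lat_finite R).toFinset with hF
  have hinj : Function.Injective (fun p : ℤ × ℤ => (p.1, p.2 + 1)) := by
    rintro ⟨a, b⟩ ⟨c, d⟩ h
    simpa using h
  set F' := F.image (fun p : ℤ × ℤ => (p.1, p.2 + 1)) with hF'
  have hs : ∑ p ∈ F, G (p.1, p.2 + 1) = ∑ p ∈ F', G p := by
    rw [hF', Finset.sum_image hinj.injOn]
  rw [Finset.sum_sub_distrib, hs, ← Finset.sum_sdiff_sub_sum_sdiff]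
  have hD : latticeCount (symmDiffTranslate R) = (F \ F').card + (F' \ F).card := by
    unfold latticeCount
    rw [← Finset.card_union_of_disjoint disjoint_sdiff_sdiff, ← Set.ncard_coe_finset]
    congr 1
    rw [lat_delta]
    ext ⟨x, y⟩
    have e1 : ∀ q : ℤ × ℤ, q ∈ F ↔ q ∈ latticePts R.carrier := fun q => by
      rw [hF, Set.Finite.mem_toFinset]
    have e2 : (x, y) ∈ F' ↔ (x, y - 1) ∈ latticePts R.carrier := by
      rw [hF', Finset.mem_image]
      constructor
      · rintro ⟨⟨a, b⟩, h, h'⟩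
        simp only [Prod.mk.injEq] at h'
        rw [← h'.1, ← h'.2]
        simpa [e1] using h
      · intro h
        exact ⟨(x, y - 1), (e1 _).2 h, by simp⟩
    have e3 : (x, y) ∈ (fun p : ℤ × ℤ => (p.1, p.2 + 1)) '' topS R ↔
        (x, y - 1) ∈ latticePts R.carrier ∧ (x, y) ∉ latticePts R.carrier := by
      simp only [Set.mem_image, topS, Set.mem_setOf_eq]
      constructor
      · rintro ⟨⟨a, b⟩, ⟨h1, h2⟩, h'⟩
        simp only [Prod.mk.injEq] at h'
        rw [← h'.1, ← h'.2]
        exact ⟨by simpa using h1, h2⟩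
      · rintro ⟨h1, h2⟩
        exact ⟨(x, y - 1), ⟨h1, by simpa using h2⟩, by simp⟩
    rw [Set.mem_union, e3]
    simp only [Finset.coe_union, Finset.coe_sdiff, Set.mem_union, Set.mem_diff, Finset.mem_coe,
      e1, e2, botS, Set.mem_setOf_eq]
  have hb : ∀ s : Finset (ℤ × ℤ), |∑ p ∈ s, G p| ≤ s.card * K := fun s => by
    refine (Finset.abs_sum_le_sum_abs _ _).trans ?_
    refine (Finset.sum_le_card_nsmul _ _ K fun p _ => hG p).trans ?_
    simp
  rw [hD]
  push_cast
  have := abs_sub (∑ p ∈ F \ F', G p) (∑ p ∈ F' \ F, G p)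
  have h1 := hb (F \ F')
  have h2 := hb (F' \ F)
  linarith

theorem ae_zpow {Y : Type} [MeasurableSpace Y] (μ : Measure Y) (e : Y ≃ᵐ Y)
    (he : MeasurePreserving (⇑e) μ μ) (P : Y → Prop) (hP : ∀ᵐ x ∂μ, P x) (k : ℤ) :
    ∀ᵐ x ∂μ, P ((e.toEquiv ^ k) x) := by
  induction k using Int.induction_on with
  | zero => simpa using hP
  | succ i ih =>
    have := he.quasiMeasurePreserving.ae ih
    filter_upwards [this] with x hx
    rw [zpow_add_one]
    exact hx
  | pred i ih =>
    have := (he.symm e).quasiMeasurePreserving.ae ih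
    filter_upwards [this] with x hx
    rw [zpow_sub_one]
    exact hx

/-- `#(Δ_n ∩ ℤ²)/#(R_n ∩ ℤ²) → 0`, and consequently for every
ergodic setup, every `c ∈ ℝ` and every `g ∈ L^∞(X)`, the averages
`M_n (c + g - g∘T)` converge a.e. to `c`. -/
theorem stmt17 (R : ℕ → Rect) (hR : IsProcess R) :
    Tendsto (fun n => (latticeCount (symmDiffTranslate (R n)) : ℝ) /
      (latticeCount (R n).carrier : ℝ)) atTop (𝓝 0) ∧
    ∀ (X : Type) [MeasurableSpace X], ∀ (μ : Measure X) (S T : X ≃ᵐ X),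
      ErgodicSetup μ S T →
      ∀ (c : ℝ) (g : X → ℝ), MemLp g ⊤ μ →
        ∀ᵐ x ∂μ, Tendsto (fun n => ergAvg S T (R n) (fun y => c + g y - g (T y)) x)
          atTop (𝓝 c) := by
  refine ⟨part1 R hR, ?_⟩
  intro X _ μ S T hE c g hg
  obtain ⟨K, hK⟩ : ∃ K : ℝ, ∀ᵐ x ∂μ, |g x| ≤ K := by
    refine ⟨(eLpNorm g ⊤ μ).toReal, ?_⟩
    have h1 := ae_le_eLpNormEssSup (f := g) (μ := μ)
    filter_upwards [h1] with x hx
    rw [← eLpNorm_exponent_top] at hx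
    have := ENNReal.toReal_mono hg.2.ne hx
    simpa using this
  have hall : ∀ᵐ x ∂μ, ∀ p : ℤ × ℤ, |g ((S.toEquiv ^ p.1) ((T.toEquiv ^ p.2) x))| ≤ K := by
    rw [ae_all_iff]
    intro p
    exact ae_zpow μ T hE.measPres_T _ (ae_zpow μ S hE.measPres_S _ hK p.1) p.2
  filter_upwards [hall] with x hx
  have hcomm : Commute T.toEquiv S.toEquiv := by
    ext y
    exact (hE.comm y).symm
  have hT : ∀ p : ℤ × ℤ, T ((S.toEquiv ^ p.1) ((T.toEquiv ^ p.2) x)) =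
      (S.toEquiv ^ p.1) ((T.toEquiv ^ (p.2 + 1)) x) := by
    intro p
    have h1 : T.toEquiv * (S.toEquiv ^ p.1 * T.toEquiv ^ p.2) =
        S.toEquiv ^ p.1 * T.toEquiv ^ (p.2 + 1) := by
      rw [← mul_assoc, (hcomm.zpow_right p.1).eq, mul_assoc, add_comm, zpow_one_add]
    exact congrArg (fun e : Equiv.Perm X => e x) h1
  have hlim := (part1 R hR).const_mul K
  rw [mul_zero] at hlim
  rw [tendsto_iff_norm_sub_tendsto_zero]
  refine squeeze_zero (fun n => norm_nonneg _) (fun n => ?_) hlim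
  have hp : (0 : ℝ) < latticeCount (R n).carrier := by exact_mod_cast lat_pos _ (hR.1 n)
  have hsum := sum_diff_le (R n) (fun p => g ((S.toEquiv ^ p.1) ((T.toEquiv ^ p.2) x))) K hx
  have hcard : latticeCount (R n).carrier = (lat_finite (R n)).toFinset.card :=
    Set.ncard_eq_toFinset_card _ (lat_finite (R n))
  have heq : ergAvg S T (R n) (fun y => c + g y - g (T y)) x - c =
      (latticeCount (R n).carrier : ℝ)⁻¹ * ∑ p ∈ (lat_finite (R n)).toFinset,
        (g ((S.toEquiv ^ p.1) ((T.toEquiv ^ p.2) x)) -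
          g ((S.toEquiv ^ p.1) ((T.toEquiv ^ (p.2 + 1)) x))) := by
    unfold ergAvg
    rw [finsum_mem_eq_finite_toFinset_sum _ (lat_finite (R n))]
    simp only [hT, add_sub_assoc]
    rw [Finset.sum_add_distrib, Finset.sum_const, ← hcard, nsmul_eq_mul, mul_add]
    field_simp
    ring
  rw [heq, Real.norm_eq_abs, abs_mul, abs_of_pos (inv_pos.2 hp), mul_comm, ← mul_div_assoc,
    ← div_eq_mul_inv]
  exact div_le_div_of_nonneg_right hsum hp.le

end
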